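/- For every τ ∈ ℍ and every z ∈ ℂ, both series below converge absolutely and ∑_{n≥0} c(n)·j_{2k−1}(π² n z)·e^{πinτ} = e^{A(τ)z}·∑_{n≥0} π^{2n}·x(τ)^{n+k}·P_n(u(τ))·z^n. -/

import Mathlib

open Polynomial Complex

noncomputable section

/-- The theta constant `θ(τ) = ∑_{n ∈ ℤ} exp(πin²τ)`. -/
def theta (τ : ℂ) : ℂ := ∑' n : ℤ, Complex.exp (Real.pi * Complex.I * (n : ℂ) ^ 2 * τ)

/-- `θ₂(τ) = ∑_{n ∈ ℤ} exp(πi(n+1/2)²τ)`. -/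
def theta2 (τ : ℂ) : ℂ := ∑' n : ℤ, Complex.exp (Real.pi * Complex.I * ((n : ℂ) + 1/2) ^ 2 * τ)

/-- `θ₄(τ) = ∑_{n ∈ ℤ} (-1)ⁿ exp(πin²τ)`. -/
def theta4 (τ : ℂ) : ℂ :=
  ∑' n : ℤ, (-1 : ℂ) ^ n * Complex.exp (Real.pi * Complex.I * (n : ℂ) ^ 2 * τ)

/-- `x(τ) = -θ₄(τ)⁴`. -/
def xx (τ : ℂ) : ℂ := -(theta4 τ) ^ 4

/-- `y(τ) = θ₂(τ)⁴`. -/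
def yy (τ : ℂ) : ℂ := (theta2 τ) ^ 4

/-- The Hauptmodul `u(τ) = y(τ)/x(τ)`. -/
def uu (τ : ℂ) : ℂ := yy τ / xx τ

/-- `t(τ) = (1/(2πi)) θ'(τ)/θ(τ)`. -/
def tt (τ : ℂ) : ℂ := deriv theta τ / (2 * Real.pi * Complex.I * theta τ)

/-- `A(τ) = -4π² t(τ)`. -/
def AA (τ : ℂ) : ℂ := -4 * (Real.pi : ℂ) ^ 2 * tt τ

/-- `j_w(z) = ∑_{n≥0} (-1)ⁿ Γ(w+1) zⁿ/(n! Γ(n+w+1))`. -/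
def jw (w : ℝ) (z : ℂ) : ℂ :=
  ∑' n : ℕ, (-1 : ℂ) ^ n * (Real.Gamma (w + 1) : ℂ) * z ^ n /
    ((Nat.factorial n : ℂ) * (Real.Gamma (n + w + 1) : ℂ))

/-! ### Theta functions as functions of the nome -/

lemma summable_pow_natAbs_sub {r : ℝ} (h0 : 0 ≤ r) (h1 : r < 1) :
    Summable (fun n : ℤ => r ^ (n.natAbs - 1)) := by
  have h : Summable (fun n : ℕ => r ^ (n - 1)) := by
    rw [← summable_nat_add_iff 1]
    simpa using summable_geometric_of_lt_one h0 h1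
  apply Summable.of_nat_of_neg
  · simpa using h
  · simpa using h

def gsum (e : ℤ → ℕ) (q : ℂ) : ℂ := ∑' n : ℤ, q ^ (e n)

lemma gsum_bound {e : ℤ → ℕ} (he : ∀ n, n.natAbs ≤ e n + 1) {q : ℂ} {r : ℝ} (h1 : r < 1)
    (hq : ‖q‖ ≤ r) (n : ℤ) : ‖q ^ (e n)‖ ≤ r ^ (n.natAbs - 1) := by
  have h0 : 0 ≤ r := (norm_nonneg q).trans hq
  rw [norm_pow]
  calc ‖q‖ ^ e n ≤ r ^ e n := by gcongr
    _ ≤ r ^ (n.natAbs - 1) := pow_le_pow_of_le_one h0 h1.le (by have := he n; omega)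

lemma gsum_summable {e : ℤ → ℕ} (he : ∀ n, n.natAbs ≤ e n + 1) {q : ℂ} (hq : ‖q‖ < 1) :
    Summable (fun n => ‖q ^ (e n)‖) :=
  Summable.of_nonneg_of_le (fun _ => norm_nonneg _) (fun n => gsum_bound he hq le_rfl n)
    (summable_pow_natAbs_sub (norm_nonneg q) hq)

lemma gsum_differentiableOn {e : ℤ → ℕ} (he : ∀ n, n.natAbs ≤ e n + 1) :
    DifferentiableOn ℂ (gsum e) (Metric.ball 0 1) := by
  intro q hq
  have hq' : ‖q‖ < 1 := by simpa using hq
  obtain ⟨r, hr, hr1⟩ := exists_between hq'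
  have : DifferentiableOn ℂ (gsum e) (Metric.ball 0 r) := by
    apply Complex.differentiableOn_tsum_of_summable_norm
      (summable_pow_natAbs_sub ((norm_nonneg q).trans hr.le) hr1)
    · intro n; fun_prop
    · exact Metric.isOpen_ball
    · intro n w hw
      exact gsum_bound he hr1 (by simpa using (le_of_lt (by simpa using hw : ‖w‖ < r))) n
  exact (this.differentiableAt (Metric.isOpen_ball.mem_nhds (by simpa using hr))).differentiableWithinAt

def e3 (n : ℤ) : ℕ := (n ^ 2).toNat
def e2 (n : ℤ) : ℕ := (n ^ 2 + n).toNat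

lemma e3_cast (n : ℤ) : (e3 n : ℤ) = n ^ 2 := Int.toNat_of_nonneg (by positivity)
lemma e2_cast (n : ℤ) : (e2 n : ℤ) = n ^ 2 + n := Int.toNat_of_nonneg (by
  rcases le_or_gt 0 n with h | h <;> nlinarith)

lemma e3_le (n : ℤ) : n.natAbs ≤ e3 n + 1 := by
  zify; rw [e3_cast]; rcases abs_cases n with h | h <;> nlinarith [sq_nonneg (n-1), sq_nonneg (n+1)]
lemma e2_le (n : ℤ) : n.natAbs ≤ e2 n + 1 := by
  zify; rw [e2_cast]; rcases abs_cases n with h | h <;> nlinarith [sq_nonneg (n+1)]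

def g3 : ℂ → ℂ := gsum e3
def g2 : ℂ → ℂ := gsum e2

def phi : (ℤ × ℤ) ⊕ (ℤ × ℤ) → ℤ × ℤ :=
  Sum.elim (fun p => (p.1 + p.2, p.1 - p.2)) (fun p => (p.1 - p.2, -p.1 - p.2 - 1))

lemma phi_bij : Function.Bijective phi := by
  constructor
  · rintro (⟨a, b⟩ | ⟨a, b⟩) (⟨c, d⟩ | ⟨c, d⟩) h <;> simp [phi] at h ⊢ <;> omega
  · rintro ⟨m, n⟩
    rcases Int.even_or_odd' (m + n) with ⟨s, h | h⟩
    · exact ⟨Sum.inl (s, m - s), by simp [phi]; omega⟩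
    · exact ⟨Sum.inr (m - s - 1, -s - 1), by simp [phi]; omega⟩

lemma gsum_mul {e f : ℤ → ℕ} (he : ∀ n, n.natAbs ≤ e n + 1) (hf : ∀ n, n.natAbs ≤ f n + 1)
    {q : ℂ} (hq : ‖q‖ < 1) :
    gsum e q * gsum f q = ∑' p : ℤ × ℤ, q ^ (e p.1 + f p.2) := by
  rw [gsum, gsum, tsum_mul_tsum_of_summable_norm (gsum_summable he hq) (gsum_summable hf hq)]
  simp [pow_add]

lemma gsum_mul_summable {e f : ℤ → ℕ} (he : ∀ n, n.natAbs ≤ e n + 1) (hf : ∀ n, n.natAbs ≤ f n + 1)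
    {q : ℂ} (hq : ‖q‖ < 1) :
    Summable (fun p : ℤ × ℤ => q ^ (e p.1 + f p.2)) := by
  have := summable_mul_of_summable_norm (gsum_summable he hq) (gsum_summable hf hq)
  simpa [pow_add] using this

lemma gsum_sq {e : ℤ → ℕ} (he : ∀ n, n.natAbs ≤ e n + 1) {q : ℂ} (hq : ‖q‖ < 1) :
    gsum e q ^ 2 = (∑' p : ℤ × ℤ, q ^ (e (p.1 + p.2) + e (p.1 - p.2))) +
      ∑' p : ℤ × ℤ, q ^ (e (p.1 - p.2) + e (-p.1 - p.2 - 1)) := by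
  rw [sq, gsum_mul he he hq, ← (Equiv.ofBijective phi phi_bij).tsum_eq]
  have hs := (Equiv.ofBijective phi phi_bij).summable_iff.mpr (gsum_mul_summable he he hq)
  have h1 := hs.comp_injective (Sum.inl_injective)
  have h2 := hs.comp_injective (Sum.inr_injective)
  exact (HasSum.sum (f := fun c => q ^ (e ((Equiv.ofBijective phi phi_bij) c).1 + e ((Equiv.ofBijective phi phi_bij) c).2)) h1.hasSum h2.hasSum).tsum_eq

lemma norm_sq_lt {q : ℂ} (hq : ‖q‖ < 1) : ‖q ^ 2‖ < 1 := by
  rw [norm_pow]; exact pow_lt_one₀ (norm_nonneg _) hq (by norm_num)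

lemma g3_sq {q : ℂ} (hq : ‖q‖ < 1) : g3 q ^ 2 = g3 (q ^ 2) ^ 2 + q * g2 (q ^ 2) ^ 2 := by
  unfold g3 g2
  rw [gsum_sq e3_le hq, sq (gsum e3 (q^2)), sq (gsum e2 (q^2)), gsum_mul e3_le e3_le (norm_sq_lt hq),
    gsum_mul e2_le e2_le (norm_sq_lt hq), ← tsum_mul_left]
  congr 1
  · congr 1; ext p; rw [← pow_mul]; congr 1; zify; simp only [e3_cast]; ring
  · congr 1; ext p; rw [← pow_mul, ← pow_succ']; congr 1; zify; simp only [e3_cast, e2_cast]; ring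

lemma g2_sq {q : ℂ} (hq : ‖q‖ < 1) : g2 q ^ 2 = 2 * (g2 (q ^ 2) * g3 (q ^ 2)) := by
  unfold g3 g2
  rw [gsum_sq e2_le hq, gsum_mul e2_le e3_le (norm_sq_lt hq), two_mul]
  congr 1
  · congr 1; ext p; rw [← pow_mul]; congr 1; zify; simp only [e3_cast, e2_cast]; ring
  · congr 1; ext p; rw [← pow_mul]; congr 1; zify; simp only [e3_cast, e2_cast]; ring

lemma g3_zero : g3 0 = 1 := by
  unfold g3 gsum
  rw [tsum_eq_single 0]
  · simp [e3]
  · intro n hn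
    have := e3_cast n
    have h : e3 n ≠ 0 := by
      intro h; rw [h] at this; simp at this; exact hn (by simpa using this.symm)
    simp [h]

lemma g2_zero : g2 0 = 2 := by
  unfold g2 gsum
  rw [tsum_eq_sum (s := {0, -1})]
  · simp [e2]; norm_num
  · intro n hn
    have := e2_cast n
    have h : e2 n ≠ 0 := by
      intro h; rw [h] at this
      have h' : n * (n + 1) = 0 := by push_cast at this; linarith
      simp at hn
      rcases mul_eq_zero.mp h' with h' | h'
      · exact hn.1 h'
      · exact hn.2 (by omega)
    simp [h]

lemma g3_diffOn : DifferentiableOn ℂ g3 (Metric.ball 0 1) := gsum_differentiableOn e3_le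
lemma g2_diffOn : DifferentiableOn ℂ g2 (Metric.ball 0 1) := gsum_differentiableOn e2_le

lemma ball_nhds {q : ℂ} (hq : ‖q‖ < 1) : Metric.ball (0:ℂ) 1 ∈ nhds q :=
  Metric.isOpen_ball.mem_nhds (by simpa using hq)

lemma g3_diff {q : ℂ} (hq : ‖q‖ < 1) : DifferentiableAt ℂ g3 q :=
  g3_diffOn.differentiableAt (ball_nhds hq)
lemma g2_diff {q : ℂ} (hq : ‖q‖ < 1) : DifferentiableAt ℂ g2 q :=
  g2_diffOn.differentiableAt (ball_nhds hq)
lemma dg3_diff {q : ℂ} (hq : ‖q‖ < 1) : DifferentiableAt ℂ (deriv g3) q :=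
  (g3_diffOn.deriv Metric.isOpen_ball).differentiableAt (ball_nhds hq)

lemma jacobi {q : ℂ} (hq : ‖q‖ < 1) : g3 q ^ 4 - g3 (-q) ^ 4 = q * g2 q ^ 4 := by
  have h1 := g3_sq hq
  have h2 := g3_sq (q := -q) (by simpa using hq)
  have h3 := g2_sq hq
  rw [neg_sq] at h2
  have e1 : g3 q ^ 4 = (g3 q ^ 2) ^ 2 := by ring
  have e2 : g3 (-q) ^ 4 = (g3 (-q) ^ 2) ^ 2 := by ring
  have e3 : g2 q ^ 4 = (g2 q ^ 2) ^ 2 := by ring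
  rw [e1, e2, e3, h1, h2, h3]; ring

/-- AGM relation for the fourth power -/
lemma g4_agm {q : ℂ} (hq : ‖q‖ < 1) : g3 (-q ^ 2) ^ 4 = g3 q ^ 2 * g3 (-q) ^ 2 := by
  have h1 := g3_sq hq
  have h2 := g3_sq (q := -q) (by simpa using hq)
  have h3 := jacobi (norm_sq_lt hq)
  rw [neg_sq] at h2
  rw [h1, h2]; linear_combination -h3

lemma tendsto_iter {q : ℂ} (hq : ‖q‖ < 1) :
    Filter.Tendsto (fun n : ℕ => q ^ (2 ^ n)) Filter.atTop (nhds 0) :=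
  (tendsto_pow_atTop_nhds_zero_of_norm_lt_one hq).comp
    (tendsto_pow_atTop_atTop_of_one_lt (by norm_num : 1 < 2))

lemma norm_iter {q : ℂ} (hq : ‖q‖ < 1) (n : ℕ) : ‖q ^ (2 ^ n)‖ < 1 := by
  rw [norm_pow]; exact pow_lt_one₀ (norm_nonneg _) hq (by positivity)

lemma ne_zero_of_iter {g : ℂ → ℂ} (hg : ContinuousAt g 0) (h0 : g 0 ≠ 0)
    (hrec : ∀ q, ‖q‖ < 1 → g q = 0 → g (q ^ 2) = 0) {q : ℂ} (hq : ‖q‖ < 1) : g q ≠ 0 := by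
  intro h
  have hz : ∀ n : ℕ, g (q ^ (2 ^ n)) = 0 := by
    intro n
    induction n with
    | zero => simpa using h
    | succ n ih =>
      have := hrec _ (norm_iter hq n) ih
      rwa [← pow_mul, ← pow_succ] at this
  have ht := hg.tendsto.comp (tendsto_iter hq)
  have : (g ∘ fun n : ℕ => q ^ (2 ^ n)) = fun _ => 0 := funext hz
  rw [this] at ht
  exact h0 (tendsto_nhds_unique ht tendsto_const_nhds)

lemma g3_ne {q : ℂ} (hq : ‖q‖ < 1) : g3 q ≠ 0 := by
  have key : ∀ q : ℂ, ‖q‖ < 1 → g3 (-q) ≠ 0 := by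
    intro q hq
    refine ne_zero_of_iter (g := fun q => g3 (-q)) ?_ (by simp [g3_zero]) ?_ hq
    · have : ContinuousAt g3 (-0) := by simpa using (g3_diff (q := 0) (by simp)).continuousAt
      exact ContinuousAt.comp (g := g3) this continuousAt_neg
    · intro q hq h
      have := g4_agm hq
      change g3 (-q) = 0 at h
      rw [h] at this
      simpa using this
  simpa using key (-q) (by simpa using hq)

lemma g2_ne {q : ℂ} (hq : ‖q‖ < 1) : g2 q ≠ 0 := by
  refine ne_zero_of_iter (g2_diff (by simp)).continuousAt (by simp [g2_zero]) ?_ hq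
  intro q hq h
  have := g2_sq hq
  rw [h] at this
  have h3 := g3_ne (norm_sq_lt hq)
  simpa [h3] using this.symm

/-! ### Differential equations -/

lemma norm_neg_lt {q : ℂ} (hq : ‖q‖ < 1) : ‖-q‖ < 1 := by simpa using hq

lemma hd3 {q : ℂ} (hq : ‖q‖ < 1) : HasDerivAt g3 (deriv g3 q) q := (g3_diff hq).hasDerivAt

lemma hd3neg {q : ℂ} (hq : ‖q‖ < 1) : HasDerivAt (fun q => g3 (-q)) (-deriv g3 (-q)) q := by
  have := (hd3 (norm_neg_lt hq)).comp q (hasDerivAt_neg q)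
  simpa [Function.comp_def] using this

lemma hd3sq {q : ℂ} (hq : ‖q‖ < 1) : HasDerivAt (fun q => g3 (q ^ 2)) (deriv g3 (q ^ 2) * (2 * q)) q := by
  have := (hd3 (norm_sq_lt hq)).comp q (hasDerivAt_pow 2 q)
  simpa [Function.comp_def] using this

lemma hd3negsq {q : ℂ} (hq : ‖q‖ < 1) :
    HasDerivAt (fun q => g3 (-q ^ 2)) (deriv g3 (-q ^ 2) * (-(2 * q))) q := by
  have := (hd3 (norm_neg_lt (norm_sq_lt hq))).comp q (hasDerivAt_pow 2 q).neg
  simpa [Function.comp_def] using this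

lemma g3_agm {q : ℂ} (hq : ‖q‖ < 1) : g3 (q ^ 2) ^ 2 = (g3 q ^ 2 + g3 (-q) ^ 2) / 2 := by
  have h1 := g3_sq hq
  have h2 := g3_sq (norm_neg_lt hq)
  rw [neg_sq] at h2
  rw [h1, h2]; ring

lemma deriv_unique_on_ball {f g : ℂ → ℂ} (h : ∀ q, ‖q‖ < 1 → f q = g q) {q f' g' : ℂ}
    (hq : ‖q‖ < 1) (hf : HasDerivAt f f' q) (hg : HasDerivAt g g' q) : f' = g' := by
  have : f =ᶠ[nhds q] g := by
    filter_upwards [ball_nhds hq] with w hw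
    exact h w (by simpa using hw)
  exact (hf.congr_of_eventuallyEq this.symm).unique hg

lemma D1 {q : ℂ} (hq : ‖q‖ < 1) :
    4 * q * g3 (q ^ 2) * deriv g3 (q ^ 2) = g3 q * deriv g3 q - g3 (-q) * deriv g3 (-q) := by
  have := deriv_unique_on_ball (fun q hq => g3_agm hq) hq ((hd3sq hq).pow 2)
    ((((hd3 hq).pow 2).add ((hd3neg hq).pow 2)).div_const 2)
  norm_num at this
  linear_combination this

lemma D2 {q : ℂ} (hq : ‖q‖ < 1) :
    -8 * q * g3 (-q ^ 2) ^ 3 * deriv g3 (-q ^ 2) =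
      2 * g3 q * g3 (-q) ^ 2 * deriv g3 q - 2 * g3 q ^ 2 * g3 (-q) * deriv g3 (-q) := by
  have := deriv_unique_on_ball (fun q hq => g4_agm hq) hq ((hd3negsq hq).pow 4)
    (((hd3 hq).pow 2).mul ((hd3neg hq).pow 2))
  norm_num at this
  linear_combination this

lemma dg3_zero : deriv g3 0 = 2 := by
  have h0 : ‖(0:ℂ)‖ < 1 := by simp
  have h2 : HasDerivAt (fun q => g2 (q ^ 2)) 0 0 := by
    have := ((g2_diff (norm_sq_lt h0)).hasDerivAt).comp 0 (hasDerivAt_pow 2 (0:ℂ))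
    simpa [Function.comp_def] using this
  have := deriv_unique_on_ball (fun q hq => g3_sq hq) h0 ((hd3 h0).pow 2)
    (((hd3sq h0).pow 2).add ((hasDerivAt_id (0:ℂ)).mul (h2.pow 2)))
  norm_num [g3_zero, g2_zero] at this
  linear_combination this / 2

def psi (q : ℂ) : ℂ := (deriv g3 q / g3 q + deriv g3 (-q) / g3 (-q)) / g2 q ^ 4

lemma psi_zero : psi 0 = 1 / 4 := by
  simp [psi, g3_zero, g2_zero, dg3_zero]; norm_num

lemma psi_cont : ContinuousAt psi 0 := by
  have h0 : ‖(0:ℂ)‖ < 1 := by simp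
  have c3 := (g3_diff h0).continuousAt
  have cd := (dg3_diff h0).continuousAt
  have c2 := (g2_diff h0).continuousAt
  have c3' : ContinuousAt (fun q => g3 (-q)) 0 := (hd3neg h0).continuousAt
  have cd' : ContinuousAt (fun q => deriv g3 (-q)) 0 :=
    ContinuousAt.comp (g := deriv g3) (by simpa using cd) continuousAt_neg
  unfold psi
  exact ((cd.div c3 (by simp [g3_zero])).add (cd'.div c3' (by simp [g3_zero]))).div (c2.pow 4)
    (by simp [g2_zero])

lemma sub_sq_id {q : ℂ} (hq : ‖q‖ < 1) :
    4 * (q ^ 2 * g2 (q ^ 2) ^ 4) = (g3 q ^ 2 - g3 (-q) ^ 2) ^ 2 := by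
  have h := jacobi (norm_sq_lt hq)
  rw [g4_agm hq] at h
  have h1 := g3_agm hq
  rw [← h, show g3 (q^2) ^ 4 = (g3 (q^2) ^ 2)^2 by ring, h1]; ring

lemma logA {q : ℂ} (hq : ‖q‖ < 1) (h0 : q ≠ 0) : deriv g3 (q ^ 2) / g3 (q ^ 2) =
    (g3 q ^ 2 * (deriv g3 q / g3 q) - g3 (-q) ^ 2 * (deriv g3 (-q) / g3 (-q))) /
      (2 * q * (g3 q ^ 2 + g3 (-q) ^ 2)) := by
  have ha := g3_ne hq
  have hb := g3_ne (norm_neg_lt hq)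
  have hA := g3_ne (norm_sq_lt hq)
  have e : g3 q ^ 2 + g3 (-q) ^ 2 = 2 * g3 (q ^ 2) ^ 2 := by rw [g3_agm hq]; ring
  have d := D1 hq
  rw [e]
  have e1 : g3 q ^ 2 * (deriv g3 q / g3 q) = g3 q * deriv g3 q := by field_simp
  have e2 : g3 (-q) ^ 2 * (deriv g3 (-q) / g3 (-q)) = g3 (-q) * deriv g3 (-q) := by field_simp
  rw [e1, e2, ← d]
  field_simp; norm_num

lemma logB {q : ℂ} (hq : ‖q‖ < 1) (h0 : q ≠ 0) : deriv g3 (-q ^ 2) / g3 (-q ^ 2) =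
    -(deriv g3 q / g3 q - deriv g3 (-q) / g3 (-q)) / (4 * q) := by
  have ha := g3_ne hq
  have hb := g3_ne (norm_neg_lt hq)
  have hB := g3_ne (norm_neg_lt (norm_sq_lt hq))
  have d := D2 hq
  have e := g4_agm hq
  rw [div_eq_div_iff hB (by simpa using h0)]
  have e1 : deriv g3 q / g3 q - deriv g3 (-q) / g3 (-q) =
    (2 * g3 q * g3 (-q) ^ 2 * deriv g3 q - 2 * g3 q ^ 2 * g3 (-q) * deriv g3 (-q)) /
      (2 * (g3 q ^ 2 * g3 (-q) ^ 2)) := by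
    field_simp
  rw [e1, ← d, ← e]
  field_simp; ring

lemma psi_iter {q : ℂ} (hq : ‖q‖ < 1) : psi (q ^ 2) = psi q := by
  rcases eq_or_ne q 0 with rfl | h0
  · simp
  have hg := g2_ne (norm_sq_lt hq)
  have hg' := g2_ne hq
  have e := sub_sq_id hq
  have j := jacobi hq
  have hA := g3_ne (norm_sq_lt hq)
  have hp : g3 q ^ 2 + g3 (-q) ^ 2 ≠ 0 := by
    rw [show g3 q ^ 2 + g3 (-q) ^ 2 = 2 * g3 (q ^ 2) ^ 2 by rw [g3_agm hq]; ring]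
    exact mul_ne_zero two_ne_zero (pow_ne_zero _ hA)
  have hm : g3 q ^ 2 - g3 (-q) ^ 2 ≠ 0 := by
    intro h
    rw [h] at e
    have : 4 * (q ^ 2 * g2 (q ^ 2) ^ 4) ≠ 0 :=
      mul_ne_zero (by norm_num) (mul_ne_zero (pow_ne_zero _ h0) (pow_ne_zero _ hg))
    exact this (by simpa using e)
  have e' : g2 (q ^ 2) ^ 4 = (g3 q ^ 2 - g3 (-q) ^ 2) ^ 2 / (4 * q ^ 2) := by
    rw [← e]; field_simp
  have j' : g2 q ^ 4 = (g3 q ^ 2 - g3 (-q) ^ 2) * (g3 q ^ 2 + g3 (-q) ^ 2) / q := by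
    rw [eq_div_iff h0]; linear_combination -j
  unfold psi
  rw [logA hq h0, logB hq h0, e', j']
  generalize deriv g3 q / g3 q = p
  generalize deriv g3 (-q) / g3 (-q) = r
  generalize g3 q = a at *
  generalize g3 (-q) = b at *
  field_simp
  ring

lemma psi_eq {q : ℂ} (hq : ‖q‖ < 1) : psi q = 1 / 4 := by
  have hz : ∀ n : ℕ, psi (q ^ (2 ^ n)) = psi q := by
    intro n
    induction n with
    | zero => simp
    | succ n ih =>
      have := psi_iter (norm_iter hq n)
      rw [← pow_mul, ← pow_succ] at this
      rw [this, ih]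
  have ht := psi_cont.tendsto.comp (tendsto_iter hq)
  have : (psi ∘ fun n : ℕ => q ^ (2 ^ n)) = fun _ => psi q := funext hz
  rw [this, psi_zero] at ht
  exact tendsto_nhds_unique tendsto_const_nhds ht

def LL (q : ℂ) : ℂ := q * (deriv g3 q / g3 q)

lemma LL_neg {q : ℂ} (hq : ‖q‖ < 1) : LL (-q) = LL q - (g3 q ^ 4 - g3 (-q) ^ 4) / 4 := by
  have h := psi_eq hq
  have hg' := g2_ne hq
  rw [psi, div_eq_iff (pow_ne_zero _ hg')] at h
  rw [jacobi hq]
  unfold LL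
  linear_combination -q * h

lemma LL_diffOn : DifferentiableOn ℂ LL (Metric.ball 0 1) := by
  intro q hq
  have hq' : ‖q‖ < 1 := by simpa using hq
  exact (differentiableAt_id.mul ((dg3_diff hq').div (g3_diff hq') (g3_ne hq'))).differentiableWithinAt

lemma LL_diff {q : ℂ} (hq : ‖q‖ < 1) : DifferentiableAt ℂ LL q :=
  LL_diffOn.differentiableAt (ball_nhds hq)

lemma dLL_diff {q : ℂ} (hq : ‖q‖ < 1) : DifferentiableAt ℂ (deriv LL) q :=
  (LL_diffOn.deriv Metric.isOpen_ball).differentiableAt (ball_nhds hq)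

lemma LL_sq {q : ℂ} (hq : ‖q‖ < 1) :
    LL (q ^ 2) = LL q / 2 - (g3 q ^ 2 * g3 (-q) ^ 2 - g3 (-q) ^ 4) / 8 := by
  rcases eq_or_ne q 0 with rfl | h0
  · simp [LL, g3_zero]
  have hA := g3_ne (norm_sq_lt hq)
  have hp : g3 q ^ 2 + g3 (-q) ^ 2 ≠ 0 := by
    rw [show g3 q ^ 2 + g3 (-q) ^ 2 = 2 * g3 (q ^ 2) ^ 2 by rw [g3_agm hq]; ring]
    exact mul_ne_zero two_ne_zero (pow_ne_zero _ hA)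
  have h := LL_neg hq
  have e : LL (q ^ 2) = (g3 q ^ 2 * LL q + g3 (-q) ^ 2 * LL (-q)) / (2 * (g3 q ^ 2 + g3 (-q) ^ 2)) := by
    unfold LL
    rw [logA hq h0]
    field_simp
    ring
  rw [e, h]
  field_simp
  ring

lemma LL_sq' {q : ℂ} (hq : ‖q‖ < 1) :
    2 * q * deriv LL (q ^ 2) = deriv LL q / 2 - (2 * g3 q * deriv g3 q * g3 (-q) ^ 2
      - 2 * g3 q ^ 2 * g3 (-q) * deriv g3 (-q) + 4 * g3 (-q) ^ 3 * deriv g3 (-q)) / 8 := by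
  have h1 : HasDerivAt (fun q => LL (q ^ 2)) (deriv LL (q ^ 2) * (2 * q)) q := by
    have := ((LL_diff (norm_sq_lt hq)).hasDerivAt).comp q (hasDerivAt_pow 2 q)
    simpa [Function.comp_def] using this
  have := deriv_unique_on_ball (fun q hq => LL_sq hq) hq h1
    (((LL_diff hq).hasDerivAt.div_const 2).sub
      (((((hd3 hq).pow 2).mul ((hd3neg hq).pow 2)).sub ((hd3neg hq).pow 4)).div_const 8))
  norm_num at this
  linear_combination this

def HH (q : ℂ) : ℂ := q * deriv LL q - 2 * LL q ^ 2 - g3 (-q) ^ 4 * (g3 q ^ 4 - g3 (-q) ^ 4) / 8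

lemma HH_sq {q : ℂ} (hq : ‖q‖ < 1) : HH q = 4 * HH (q ^ 2) := by
  have ha := g3_ne hq
  have hb := g3_ne (norm_neg_lt hq)
  have h1 := LL_sq' hq
  have h2 := LL_neg hq
  have e1 : q * deriv g3 q = g3 q * LL q := by unfold LL; field_simp
  have e2 : q * deriv g3 (-q) = -g3 (-q) * LL (-q) := by unfold LL; field_simp
  rw [h2] at e2
  have e3 : g3 (q ^ 2) ^ 4 = ((g3 q ^ 2 + g3 (-q) ^ 2) / 2) ^ 2 := by rw [← g3_agm hq]; ring
  unfold HH
  rw [LL_sq hq, e3, g4_agm hq]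
  linear_combination (-2 * q) * h1 + (2 * (2 * g3 q * g3 (-q) ^ 2) / 8) * e1
    + (2 * (-2 * g3 q ^ 2 * g3 (-q) + 4 * g3 (-q) ^ 3) / 8) * e2

lemma HH_zero : HH 0 = 0 := by simp [HH, LL, g3_zero]

lemma HH_eq {q : ℂ} (hq : ‖q‖ < 1) : HH q = 0 := by
  have h0 : ‖(0:ℂ)‖ < 1 := by simp
  have hdiff : DifferentiableAt ℂ HH 0 := by
    have h3n := (hd3neg h0).differentiableAt
    have h3 := (g3_diff h0)
    have hL := LL_diff h0
    have hL' := dLL_diff h0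
    unfold HH
    fun_prop
  have hO := hdiff.hasDerivAt.isBigO_sub
  rw [HH_zero] at hO
  simp only [sub_zero] at hO
  have hz : ∀ n : ℕ, HH q = 4 ^ n * HH (q ^ (2 ^ n)) := by
    intro n
    induction n with
    | zero => simp
    | succ n ih =>
      have := HH_sq (norm_iter hq n)
      rw [← pow_mul, ← pow_succ] at this
      rw [ih, this]; ring
  have hO2 := hO.comp_tendsto (tendsto_iter hq)
  have hO3 : (fun n : ℕ => HH q) =O[Filter.atTop] (fun n : ℕ => (4:ℂ) ^ n * q ^ (2 ^ n)) := by
    have := (Asymptotics.isBigO_refl (fun n : ℕ => (4:ℂ) ^ n) Filter.atTop).mul hO2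
    refine this.congr_left ?_
    intro n; exact (hz n).symm
  have hlim : Filter.Tendsto (fun n : ℕ => (4:ℂ) ^ n * q ^ (2 ^ n)) Filter.atTop (nhds 0) := by
    have h1 := tendsto_pow_const_mul_const_pow_of_abs_lt_one 2 (r := ‖q‖) (by simpa using hq)
    have h2 := h1.comp (tendsto_pow_atTop_atTop_of_one_lt (by norm_num : 1 < 2))
    rw [tendsto_zero_iff_norm_tendsto_zero]
    refine h2.congr ?_
    intro n
    have : ((2:ℝ) ^ n) ^ 2 = 4 ^ n := by rw [← pow_mul, mul_comm, pow_mul]; norm_num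
    simp [this]
  have := hO3.trans_tendsto hlim
  exact tendsto_nhds_unique tendsto_const_nhds this

def Xq (q : ℂ) : ℂ := -g3 (-q) ^ 4
def Yq (q : ℂ) : ℂ := q * g2 q ^ 4
/-- `4 T` -/
def Sq (q : ℂ) : ℂ := 2 * LL q

lemma Xq_ne {q : ℂ} (hq : ‖q‖ < 1) : Xq q ≠ 0 := by
  have := g3_ne (norm_neg_lt hq)
  unfold Xq; exact neg_ne_zero.mpr (pow_ne_zero _ this)

lemma Xq_deriv {q : ℂ} (hq : ‖q‖ < 1) :
    ∃ d, HasDerivAt Xq d q ∧ q * d = 2 * Sq q * Xq q - Xq q * Yq q := by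
  refine ⟨_, ((hd3neg hq).pow 4).neg, ?_⟩
  have hb := g3_ne (norm_neg_lt hq)
  have e2 : q * deriv g3 (-q) = -g3 (-q) * LL (-q) := by unfold LL; field_simp
  have h2 := LL_neg hq
  rw [jacobi hq] at h2
  rw [h2] at e2
  simp only [Xq, Yq, Sq]
  norm_num
  linear_combination 4 * g3 (-q) ^ 3 * e2

lemma Yq_deriv {q : ℂ} (hq : ‖q‖ < 1) :
    ∃ d, HasDerivAt Yq d q ∧ q * d = 2 * Sq q * Yq q - Xq q * Yq q := by
  obtain ⟨d, hd, hd'⟩ := Xq_deriv hq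
  have ha := g3_ne hq
  have h : HasDerivAt Yq (4 * g3 q ^ 3 * deriv g3 q + d) q := by
    have := ((hd3 hq).pow 4).add hd
    norm_num at this
    refine this.congr_of_eventuallyEq ?_
    filter_upwards [ball_nhds hq] with w hw
    have := jacobi (q := w) (by simpa using hw)
    simp [Yq, Xq, ← this]; ring
  refine ⟨_, h, ?_⟩
  have e1 : q * deriv g3 q = g3 q * LL q := by unfold LL; field_simp
  have j := jacobi hq
  have j' : g3 q ^ 4 = Yq q - Xq q := by simp only [Yq, Xq]; linear_combination j
  rw [mul_add, hd']
  have : Sq q = 2 * LL q := rfl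
  linear_combination 4 * g3 q ^ 3 * e1 + 4 * LL q * j' + 2 * (Xq q - Yq q) * this

lemma Sq_deriv {q : ℂ} (hq : ‖q‖ < 1) :
    ∃ d, HasDerivAt Sq d q ∧ q * d = Sq q ^ 2 - Xq q * Yq q / 4 := by
  refine ⟨_, (LL_diff hq).hasDerivAt.const_mul 2, ?_⟩
  have h := HH_eq hq
  have j := jacobi hq
  unfold HH at h
  rw [j] at h
  simp only [Sq, Xq, Yq]
  linear_combination 2 * h

/-! ### Formal power series in `z` -/

section formal
open PowerSeries in
def Eser (S : ℂ) : PowerSeries ℂ := PowerSeries.mk (fun j => S ^ j / (Nat.factorial j : ℂ))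

lemma Eser_eq (S : ℂ) : Eser S = PowerSeries.rescale S (PowerSeries.exp ℂ) := by
  ext n
  simp [Eser, PowerSeries.coeff_rescale, PowerSeries.coeff_exp, div_eq_mul_inv]

lemma Eser_mul (S : ℂ) : Eser (-S) * Eser S = 1 := by
  rw [Eser_eq, Eser_eq, PowerSeries.exp_mul_exp_eq_exp_add]
  simp

lemma Eser_deriv (S : ℂ) : PowerSeries.derivative ℂ (Eser S) = PowerSeries.C S * Eser S := by
  ext n
  have h : ((n:ℂ) + 1) ≠ 0 := by exact_mod_cast Nat.succ_ne_zero n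
  have h' : (Nat.factorial n : ℂ) ≠ 0 := by exact_mod_cast Nat.factorial_ne_zero n
  simp only [Eser, PowerSeries.coeff_derivative, PowerSeries.coeff_mk, PowerSeries.coeff_C_mul,
    Nat.factorial_succ]
  push_cast
  field_simp
  ring

lemma formal_rec (k : ℕ) (Q dQ : ℕ → ℂ) (S w : ℂ)
    (h : ∀ m : ℕ, ((m:ℂ) + 1) * (m + 2 * k) * Q (m + 1) =
      -dQ m + 2 * S * (m + k) * Q m - w / 4 * (if m = 0 then 0 else Q (m - 1))) (m : ℕ) :
    ((m:ℂ) + 1) * (m + 2 * k) * PowerSeries.coeff (m + 1) (PowerSeries.mk Q * Eser (-S)) =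
      -PowerSeries.coeff m (PowerSeries.mk dQ * Eser (-S) + PowerSeries.mk Q *
        (PowerSeries.C (-(S ^ 2 - w / 4)) * (PowerSeries.X * Eser (-S)))) := by
  set D := PowerSeries.derivative ℂ with hD
  set q := PowerSeries.mk Q with hq
  set E := Eser (-S) with hE
  have ode : PowerSeries.X * D (D q) + PowerSeries.C (2 * k : ℂ) * D q =
      -PowerSeries.mk dQ + PowerSeries.C (2 * S) * (PowerSeries.X * D q)
        + PowerSeries.C (2 * k * S) * q - PowerSeries.C (w / 4) * (PowerSeries.X * q) := by
    ext n
    have hn := h n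
    cases n with
    | zero =>
      simp only [hD, hq, map_add, map_sub, map_neg, PowerSeries.coeff_C_mul,
        PowerSeries.coeff_zero_X_mul, PowerSeries.coeff_derivative, PowerSeries.coeff_mk]
      simp at hn ⊢
      linear_combination hn
    | succ n =>
      simp only [hD, hq, map_add, map_sub, map_neg, PowerSeries.coeff_C_mul,
        PowerSeries.coeff_succ_X_mul, PowerSeries.coeff_derivative, PowerSeries.coeff_mk]
      simp at hn ⊢
      linear_combination hn
  have hDE : D E = PowerSeries.C (-S) * E := Eser_deriv (-S)
  have ode2 : PowerSeries.X * D (D (q * E)) + PowerSeries.C (2 * k : ℂ) * D (q * E) =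
      -(PowerSeries.mk dQ * E + q * (PowerSeries.C (-(S ^ 2 - w / 4)) * (PowerSeries.X * E))) := by
    have hC : D (PowerSeries.C (-S)) = 0 := PowerSeries.derivative_C
    simp only [Derivation.leibniz, smul_eq_mul, hDE, map_add, hC]
    have h2 : PowerSeries.C (2:ℂ) = 2 := map_ofNat _ 2
    simp only [map_neg, map_mul, map_sub, map_pow, h2] at ode ⊢
    linear_combination E * ode
  have := congrArg (PowerSeries.coeff m) ode2
  rw [map_neg] at this
  rw [← this]
  cases m with
  | zero =>
    simp only [hD, map_add, PowerSeries.coeff_C_mul, PowerSeries.coeff_derivative,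
      PowerSeries.coeff_zero_X_mul]
    push_cast; ring
  | succ n =>
    simp only [hD, map_add, PowerSeries.coeff_C_mul, PowerSeries.coeff_derivative,
      PowerSeries.coeff_succ_X_mul]
    push_cast; ring
end formal

/-! ### The holomorphic recursion -/

lemma uq_deriv {q : ℂ} (hq : ‖q‖ < 1) : ∃ d, HasDerivAt (fun q => Yq q / Xq q) d q ∧
    q * d = Xq q * ((Yq q / Xq q) ^ 2 - Yq q / Xq q) := by
  obtain ⟨dx, hx, hx'⟩ := Xq_deriv hq
  obtain ⟨dy, hy, hy'⟩ := Yq_deriv hq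
  have h0 := Xq_ne hq
  refine ⟨_, hy.div hx h0, ?_⟩
  field_simp
  linear_combination Xq q * hy' - Yq q * hx'

def Qq (k : ℕ) (Pn : ℕ → Polynomial ℂ) (m : ℕ) (q : ℂ) : ℂ :=
  Xq q ^ (m + k) * (Pn m).eval (Yq q / Xq q)

def dQq (k : ℕ) (Pn : ℕ → Polynomial ℂ) (m : ℕ) (q : ℂ) : ℂ :=
  (m + k) * (2 * Sq q - Yq q) * Qq k Pn m q +
    Xq q ^ (m + k + 1) * ((Yq q / Xq q) ^ 2 - Yq q / Xq q) *
      (Polynomial.derivative (Pn m)).eval (Yq q / Xq q)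

lemma Qq_deriv (k : ℕ) (hk : 1 ≤ k) (Pn : ℕ → Polynomial ℂ) (m : ℕ) {q : ℂ} (hq : ‖q‖ < 1) :
    ∃ d, HasDerivAt (Qq k Pn m) d q ∧ q * d = dQq k Pn m q := by
  obtain ⟨dx, hx, hx'⟩ := Xq_deriv hq
  obtain ⟨du, hu, hu'⟩ := uq_deriv hq
  have hp := ((Pn m).hasDerivAt (Yq q / Xq q)).comp q hu
  refine ⟨_, (hx.pow (m + k)).mul hp, ?_⟩
  obtain ⟨j, rfl⟩ : ∃ j, k = j + 1 := ⟨k - 1, by omega⟩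
  simp only [dQq, Qq, ← add_assoc, Nat.add_sub_cancel, Pi.pow_apply]
  push_cast
  linear_combination ((m:ℂ) + j + 1) * Xq q ^ (m + j) * (Pn m).eval (Yq q / Xq q) * hx' +
    Xq q ^ (m + j + 1) * (Polynomial.derivative (Pn m)).eval (Yq q / Xq q) * hu'

lemma Qq_rec (k : ℕ) (hk : 1 ≤ k) (Pn : ℕ → Polynomial ℂ)
    (hPnrec : ∀ n : ℕ,
      (((n : ℂ) + 1) * ((n : ℂ) + 2 * k)) • Pn (n + 1)
        + (X ^ 2 - X) * Polynomial.derivative (Pn n)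
        - ((n : ℂ) + k) • (X * Pn n)
        + (1/4 : ℂ) • (X * (if n = 0 then 0 else Pn (n - 1))) = 0)
    {q : ℂ} (hq : ‖q‖ < 1) (m : ℕ) :
    ((m:ℂ) + 1) * (m + 2 * k) * Qq k Pn (m + 1) q =
      -dQq k Pn m q + 2 * Sq q * (m + k) * Qq k Pn m q
        - Xq q * Yq q / 4 * (if m = 0 then 0 else Qq k Pn (m - 1) q) := by
  have h0 := Xq_ne hq
  have h := congrArg (Polynomial.eval (Yq q / Xq q)) (hPnrec m)
  have hY : Yq q = Xq q * (Yq q / Xq q) := by field_simp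
  cases m with
  | zero =>
    simp only [Polynomial.eval_add, Polynomial.eval_sub, Polynomial.eval_mul, Polynomial.eval_smul,
      Polynomial.eval_pow, Polynomial.eval_X, smul_eq_mul, if_true, Polynomial.eval_zero] at h
    simp only [Qq, dQq, if_true]
    generalize Yq q / Xq q = u at *
    rw [hY]
    simp only [Nat.cast_zero, zero_add] at *
    linear_combination Xq q ^ (k + 1) * h
  | succ n =>
    simp only [Polynomial.eval_add, Polynomial.eval_sub, Polynomial.eval_mul, Polynomial.eval_smul,
      Polynomial.eval_pow, Polynomial.eval_X, smul_eq_mul, Nat.succ_ne_zero, if_false,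
      Nat.add_sub_cancel, Polynomial.eval_zero] at h
    simp only [Qq, dQq, Nat.succ_ne_zero, if_false, Nat.add_sub_cancel]
    generalize Yq q / Xq q = u at *
    rw [hY]
    push_cast at *
    linear_combination Xq q ^ (n + k + 2) * h

def Cq (k : ℕ) (Pn : ℕ → Polynomial ℂ) (m : ℕ) (q : ℂ) : ℂ :=
  PowerSeries.coeff m (PowerSeries.mk (fun i => Qq k Pn i q) * Eser (-Sq q))

lemma Eq_deriv (j : ℕ) {q : ℂ} (hq : ‖q‖ < 1) :
    ∃ d, HasDerivAt (fun q => PowerSeries.coeff j (Eser (-Sq q))) d q ∧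
      q * d = PowerSeries.coeff j (PowerSeries.C (-(Sq q ^ 2 - Xq q * Yq q / 4)) *
        (PowerSeries.X * Eser (-Sq q))) := by
  obtain ⟨d, hd, hd'⟩ := Sq_deriv hq
  simp only [Eser, PowerSeries.coeff_mk]
  refine ⟨_, (hd.neg.pow j).div_const _, ?_⟩
  cases j with
  | zero => simp
  | succ n =>
    have h : ((n:ℂ) + 1) ≠ 0 := by exact_mod_cast Nat.succ_ne_zero n
    have h' : (Nat.factorial n : ℂ) ≠ 0 := by exact_mod_cast Nat.factorial_ne_zero n
    rw [PowerSeries.coeff_C_mul, PowerSeries.coeff_succ_X_mul, PowerSeries.coeff_mk, ← hd']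
    simp only [Nat.factorial_succ, Nat.add_sub_cancel, Pi.neg_apply]
    push_cast
    field_simp

lemma Cq_deriv (k : ℕ) (hk : 1 ≤ k) (Pn : ℕ → Polynomial ℂ) (m : ℕ) {q : ℂ} (hq : ‖q‖ < 1) :
    ∃ d, HasDerivAt (Cq k Pn m) d q ∧ q * d =
      PowerSeries.coeff m (PowerSeries.mk (fun i => dQq k Pn i q) * Eser (-Sq q) +
        PowerSeries.mk (fun i => Qq k Pn i q) *
        (PowerSeries.C (-(Sq q ^ 2 - Xq q * Yq q / 4)) * (PowerSeries.X * Eser (-Sq q)))) := by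
  choose dQ hdQ hdQ' using fun i => Qq_deriv k hk Pn i hq
  choose dE hdE hdE' using fun i => Eq_deriv i hq
  have h := HasDerivAt.fun_sum (u := Finset.HasAntidiagonal.antidiagonal m) (fun p _ => (hdQ p.1).mul (hdE p.2))
  refine ⟨_, h.congr_of_eventuallyEq (Filter.Eventually.of_forall fun w => ?_), ?_⟩
  · simp [Cq, PowerSeries.coeff_mul]
  · rw [map_add, PowerSeries.coeff_mul, PowerSeries.coeff_mul, Finset.mul_sum,
      ← Finset.sum_add_distrib]
    refine Finset.sum_congr rfl fun p _ => ?_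
    rw [PowerSeries.coeff_mk, PowerSeries.coeff_mk, ← hdQ', ← hdE']
    ring

lemma Cq_rec (k : ℕ) (hk : 1 ≤ k) (Pn : ℕ → Polynomial ℂ)
    (hPnrec : ∀ n : ℕ,
      (((n : ℂ) + 1) * ((n : ℂ) + 2 * k)) • Pn (n + 1)
        + (X ^ 2 - X) * Polynomial.derivative (Pn n)
        - ((n : ℂ) + k) • (X * Pn n)
        + (1/4 : ℂ) • (X * (if n = 0 then 0 else Pn (n - 1))) = 0)
    {q : ℂ} (hq : ‖q‖ < 1) (m : ℕ) :
    ∃ d, HasDerivAt (Cq k Pn m) d q ∧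
      ((m:ℂ) + 1) * (m + 2 * k) * Cq k Pn (m + 1) q = -(q * d) := by
  obtain ⟨d, hd, hd'⟩ := Cq_deriv k hk Pn m hq
  refine ⟨d, hd, ?_⟩
  rw [hd']
  exact formal_rec k (fun i => Qq k Pn i q) (fun i => dQq k Pn i q) (Sq q) (Xq q * Yq q)
    (Qq_rec k hk Pn hPnrec hq) m

/-! ### The Bessel coefficients and the `q`-series -/

def gam (k m : ℕ) : ℂ := (-1 : ℂ) ^ m * (Real.Gamma ((2 * k - 1 : ℝ) + 1) : ℂ) /
    ((Nat.factorial m : ℂ) * (Real.Gamma (m + (2 * k - 1 : ℝ) + 1) : ℂ))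

lemma jw_eq (k : ℕ) (z : ℂ) : jw (2 * k - 1) z = ∑' m : ℕ, gam k m * z ^ m := by
  unfold jw gam
  congr 1; ext m; ring

lemma Gpos (k : ℕ) (hk : 1 ≤ k) (m : ℕ) : 0 < (m:ℝ) + (2 * k - 1 : ℝ) + 1 := by
  have : (1:ℝ) ≤ k := by exact_mod_cast hk
  have : (0:ℝ) ≤ m := by positivity
  linarith

lemma gam_zero (k : ℕ) (hk : 1 ≤ k) : gam k 0 = 1 := by
  have h := (Real.Gamma_pos_of_pos (Gpos k hk 0)).ne'
  have h' : (Real.Gamma (2 * k - 1 + 1) : ℂ) ≠ 0 := by simpa using h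
  unfold gam
  simp only [pow_zero, Nat.factorial_zero, Nat.cast_zero, zero_add, Nat.cast_one, one_mul]
  exact div_self h'

lemma gam_succ (k : ℕ) (hk : 1 ≤ k) (m : ℕ) :
    ((m:ℂ) + 1) * (m + 2 * k) * gam k (m + 1) = -gam k m := by
  have h := (Real.Gamma_pos_of_pos (Gpos k hk m)).ne'
  have h' : (Real.Gamma (m + (2 * k - 1 : ℝ) + 1) : ℂ) ≠ 0 := by exact_mod_cast h
  have e : Real.Gamma ((m + 1 : ℕ) + (2 * k - 1 : ℝ) + 1) =
      (m + 2 * k) * Real.Gamma (m + (2 * k - 1 : ℝ) + 1) := by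
    have := Real.Gamma_add_one (Gpos k hk m).ne'
    rw [show ((m + 1 : ℕ) : ℝ) + (2 * k - 1 : ℝ) + 1 = (m:ℝ) + (2 * k - 1 : ℝ) + 1 + 1 by
      push_cast; ring, this]
    ring
  have h1 : ((m:ℂ) + 1) ≠ 0 := by exact_mod_cast Nat.succ_ne_zero m
  have h2 : ((m:ℂ) + 2 * k) ≠ 0 := by
    have : m + 2 * k ≠ 0 := by omega
    exact_mod_cast this
  have h3 : (Nat.factorial m : ℂ) ≠ 0 := by exact_mod_cast Nat.factorial_ne_zero m
  unfold gam
  rw [e, Nat.factorial_succ]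
  push_cast at h' ⊢
  generalize (Real.Gamma (m + (2 * k - 1 : ℝ) + 1) : ℂ) = g at *
  field_simp
  ring

lemma gam_bound (k : ℕ) (hk : 1 ≤ k) (m : ℕ) : ‖gam k m‖ ≤ 1 / ((Nat.factorial m : ℝ) ^ 2) := by
  induction m with
  | zero => simp [gam_zero k hk]
  | succ m ih =>
    have h := congrArg norm (gam_succ k hk m)
    have e1 : ‖(m:ℂ) + 1‖ = (m:ℝ) + 1 := by
      have := Complex.norm_natCast (m + 1); push_cast at this; exact this
    have e2 : ‖(m:ℂ) + 2 * k‖ = (m:ℝ) + 2 * k := by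
      have := Complex.norm_natCast (m + 2 * k); push_cast at this; exact this
    rw [norm_mul, norm_mul, norm_neg, e1, e2] at h
    rw [Nat.factorial_succ]
    push_cast
    have hk' : (1:ℝ) ≤ k := by exact_mod_cast hk
    have hm : (0:ℝ) ≤ m := by positivity
    have hf : (0:ℝ) < Nat.factorial m := by exact_mod_cast Nat.factorial_pos m
    rw [le_div_iff₀ (by positivity)] at ih ⊢
    calc ‖gam k (m + 1)‖ * (((m:ℝ) + 1) * Nat.factorial m) ^ 2
        = ((m + 1) * (m + 1) * ‖gam k (m + 1)‖) * (Nat.factorial m : ℝ) ^ 2 := by ring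
      _ ≤ ((m + 1) * (m + 2 * k) * ‖gam k (m + 1)‖) * (Nat.factorial m : ℝ) ^ 2 := by
        gcongr; linarith
      _ ≤ 1 := by rw [h]; exact ih

def fser (c : ℕ → ℂ) (m : ℕ) (q : ℂ) : ℂ := ∑' n : ℕ, (n:ℂ) ^ m * c n * q ^ n

lemma fser_bound (c : ℕ → ℂ) (hcs : ∀ r : ℝ, 0 < r → r < 1 → Summable (fun n => ‖c n‖ * r ^ n))
    (m : ℕ) {r : ℝ} (hr : 0 < r) (hr1 : r < 1) :
    Summable (fun n : ℕ => (n:ℝ) ^ m * ‖c n‖ * r ^ n) := by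
  obtain ⟨s, hs, hs1⟩ := exists_between hr1
  have hs0 : 0 < s := hr.trans hs
  have hb : Filter.Tendsto (fun n : ℕ => (n:ℝ) ^ m * (r / s) ^ n) Filter.atTop (nhds 0) :=
    tendsto_pow_const_mul_const_pow_of_abs_lt_one m (by
      rw [abs_of_pos (by positivity)]; exact (div_lt_one hs0).mpr hs)
  obtain ⟨B, hB⟩ := hb.bddAbove_range
  refine Summable.of_nonneg_of_le (fun n => by positivity) (fun n => ?_) ((hcs s hs0 hs1).mul_left B)
  have := hB ⟨n, rfl⟩
  simp only at this
  calc (n:ℝ) ^ m * ‖c n‖ * r ^ n = ((n:ℝ) ^ m * (r / s) ^ n) * (‖c n‖ * s ^ n) := by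
        rw [div_pow]; field_simp
    _ ≤ B * (‖c n‖ * s ^ n) := by gcongr

lemma fser_deriv (c : ℕ → ℂ) (hcs : ∀ r : ℝ, 0 < r → r < 1 → Summable (fun n => ‖c n‖ * r ^ n))
    (m : ℕ) {q : ℂ} (hq : ‖q‖ < 1) :
    ∃ d, HasDerivAt (fser c m) d q ∧ q * d = fser c (m + 1) q := by
  obtain ⟨r, hr, hr1⟩ := exists_between hq
  have hr0 : 0 < r := (norm_nonneg q).trans_lt hr
  have hu := fser_bound c hcs m hr0 hr1
  have hF : ∀ n : ℕ, DifferentiableOn ℂ (fun q : ℂ => (n:ℂ) ^ m * c n * q ^ n) (Metric.ball 0 r) := by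
    intro n; fun_prop
  have hle : ∀ (n : ℕ) (w : ℂ), w ∈ Metric.ball (0:ℂ) r →
      ‖(n:ℂ) ^ m * c n * w ^ n‖ ≤ (n:ℝ) ^ m * ‖c n‖ * r ^ n := by
    intro n w hw
    have hw' : ‖w‖ < r := by simpa using hw
    simp only [norm_mul, norm_pow, Complex.norm_natCast]
    gcongr
  have hmem : q ∈ Metric.ball (0:ℂ) r := by simpa using hr
  have hd := (Complex.differentiableOn_tsum_of_summable_norm hu hF Metric.isOpen_ball
    hle).differentiableAt (Metric.isOpen_ball.mem_nhds hmem)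
  have hs := Complex.hasSum_deriv_of_summable_norm hu hF Metric.isOpen_ball hle hmem
  refine ⟨_, hd.hasDerivAt, ?_⟩
  rw [← hs.tsum_eq, ← tsum_mul_left]
  unfold fser
  congr 1; ext n
  rw [deriv_const_mul_field, deriv_pow_field]
  cases n with
  | zero => simp
  | succ n => simp only [Nat.add_sub_cancel]; ring

lemma Cq_eq (k : ℕ) (hk : 1 ≤ k) (Pn : ℕ → Polynomial ℂ)
    (hPnrec : ∀ n : ℕ,
      (((n : ℂ) + 1) * ((n : ℂ) + 2 * k)) • Pn (n + 1)
        + (X ^ 2 - X) * Polynomial.derivative (Pn n)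
        - ((n : ℂ) + k) • (X * Pn n)
        + (1/4 : ℂ) • (X * (if n = 0 then 0 else Pn (n - 1))) = 0)
    (c : ℕ → ℂ) (hcs : ∀ r : ℝ, 0 < r → r < 1 → Summable (fun n => ‖c n‖ * r ^ n))
    (hf : ∀ q : ℂ, ‖q‖ < 1 → q ≠ 0 → Qq k Pn 0 q = fser c 0 q) (m : ℕ) :
    ∀ q : ℂ, ‖q‖ < 1 → q ≠ 0 → Cq k Pn m q = gam k m * fser c m q := by
  induction m with
  | zero =>
    intro q hq h0
    rw [gam_zero k hk, one_mul, ← hf q hq h0]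
    simp [Cq, Eser, PowerSeries.coeff_mul]
  | succ m ih =>
    intro q hq h0
    obtain ⟨d, hd, hd'⟩ := Cq_rec k hk Pn hPnrec hq m
    obtain ⟨e, he, he'⟩ := fser_deriv c hcs m hq
    have hev : Cq k Pn m =ᶠ[nhds q] fun q => gam k m * fser c m q := by
      filter_upwards [ball_nhds hq, isOpen_ne.mem_nhds h0] with w hw hw0
      exact ih w (by simpa using hw) hw0
    have hu := (hd.congr_of_eventuallyEq hev.symm).unique (he.const_mul (gam k m))
    have h1 : ((m:ℂ) + 1) ≠ 0 := by exact_mod_cast Nat.succ_ne_zero m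
    have h2 : ((m:ℂ) + 2 * k) ≠ 0 := by
      have : m + 2 * k ≠ 0 := by omega
      exact_mod_cast this
    apply mul_left_cancel₀ (mul_ne_zero h1 h2)
    rw [hd', hu, ← he']
    linear_combination (-q * e) * gam_succ k hk m

lemma Qq_eq (k : ℕ) (Pn : ℕ → Polynomial ℂ) (m : ℕ) (q : ℂ) :
    Qq k Pn m q = ∑ p ∈ Finset.HasAntidiagonal.antidiagonal m,
      Cq k Pn p.1 q * (Sq q ^ p.2 / (Nat.factorial p.2 : ℂ)) := by
  have h : PowerSeries.mk (fun i => Qq k Pn i q) =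
      (PowerSeries.mk (fun i => Qq k Pn i q) * Eser (-Sq q)) * Eser (Sq q) := by
    rw [mul_assoc, Eser_mul, mul_one]
  have h2 := congrArg (PowerSeries.coeff m) h
  rw [PowerSeries.coeff_mk, PowerSeries.coeff_mul] at h2
  rw [h2]
  refine Finset.sum_congr rfl fun p _ => ?_
  simp [Cq, Eser]

lemma double_summable (k : ℕ) (hk : 1 ≤ k)
    (c : ℕ → ℂ) (hcs : ∀ r : ℝ, 0 < r → r < 1 → Summable (fun n => ‖c n‖ * r ^ n))
    {q : ℂ} (hq : ‖q‖ < 1) (h0 : q ≠ 0) (z : ℂ) :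
    Summable (fun p : ℕ × ℕ => ‖c p.1 * (gam k p.2 * (p.1 * z) ^ p.2) * q ^ p.1‖) := by
  have hq0 : 0 < ‖q‖ := norm_pos_iff.mpr h0
  obtain ⟨ε, hε, hε1⟩ : ∃ ε : ℝ, 0 < ε ∧ ‖q‖ * Real.exp (ε * ‖z‖) < 1 := by
    have hc : Filter.Tendsto (fun ε : ℝ => ‖q‖ * Real.exp (ε * ‖z‖)) (nhdsWithin 0 (Set.Ioi 0))
        (nhds ‖q‖) := by
      have : Continuous (fun ε : ℝ => ‖q‖ * Real.exp (ε * ‖z‖)) := by fun_prop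
      have h := (this.tendsto 0).mono_left (nhdsWithin_le_nhds (s := Set.Ioi 0))
      simpa using h
    have h1 := hc.eventually (gt_mem_nhds hq)
    obtain ⟨ε, h, h'⟩ := (h1.and self_mem_nhdsWithin).exists
    exact ⟨ε, h', h⟩
  have hs := (hcs _ (by positivity) hε1).mul_of_nonneg (Real.summable_pow_div_factorial (1 / ε))
    (fun n => by positivity) (fun n => by positivity)
  refine Summable.of_nonneg_of_le (fun _ => norm_nonneg _) ?_ hs
  rintro ⟨n, m⟩
  have hf : (0:ℝ) < Nat.factorial m := by exact_mod_cast Nat.factorial_pos m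
  simp only [norm_mul, norm_pow, Complex.norm_natCast]
  have hexp : (ε * (n * ‖z‖)) ^ m / Nat.factorial m ≤ Real.exp (ε * (n * ‖z‖)) :=
    Real.pow_div_factorial_le_exp _ (by positivity) m
  have hexp2 : Real.exp (ε * (n * ‖z‖)) = Real.exp (ε * ‖z‖) ^ n := by
    rw [← Real.exp_nat_mul]; ring_nf
  rw [hexp2] at hexp
  calc ‖c n‖ * (‖gam k m‖ * (n * ‖z‖) ^ m) * ‖q‖ ^ n
      ≤ ‖c n‖ * (1 / ((Nat.factorial m : ℝ) ^ 2) * (n * ‖z‖) ^ m) * ‖q‖ ^ n := by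
        gcongr; exact gam_bound k hk m
    _ = ‖c n‖ * ‖q‖ ^ n * ((ε * (n * ‖z‖)) ^ m / Nat.factorial m) *
        ((1 / ε) ^ m / Nat.factorial m) := by
        rw [mul_pow ε, div_pow, one_pow]; field_simp
    _ ≤ ‖c n‖ * ‖q‖ ^ n * (Real.exp (ε * ‖z‖) ^ n) *
        ((1 / ε) ^ m / Nat.factorial m) := by gcongr
    _ = _ := by rw [mul_pow]; ring

lemma main_q (k : ℕ) (hk : 1 ≤ k) (Pn : ℕ → Polynomial ℂ)
    (hPnrec : ∀ n : ℕ,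
      (((n : ℂ) + 1) * ((n : ℂ) + 2 * k)) • Pn (n + 1)
        + (X ^ 2 - X) * Polynomial.derivative (Pn n)
        - ((n : ℂ) + k) • (X * Pn n)
        + (1/4 : ℂ) • (X * (if n = 0 then 0 else Pn (n - 1))) = 0)
    (c : ℕ → ℂ) (hcs : ∀ r : ℝ, 0 < r → r < 1 → Summable (fun n => ‖c n‖ * r ^ n))
    (hf : ∀ q : ℂ, ‖q‖ < 1 → q ≠ 0 → Qq k Pn 0 q = fser c 0 q)
    {q : ℂ} (hq : ‖q‖ < 1) (h0 : q ≠ 0) (z : ℂ) :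
    Summable (fun n : ℕ => ‖c n * jw (2 * k - 1) (n * z) * q ^ n‖) ∧
    Summable (fun n : ℕ => ‖Qq k Pn n q * z ^ n‖) ∧
    ∑' n : ℕ, c n * jw (2 * k - 1) (n * z) * q ^ n =
      Complex.exp (-Sq q * z) * ∑' n : ℕ, Qq k Pn n q * z ^ n := by
  have hds := double_summable k hk c hcs hq h0 z
  have hds' : Summable (fun p : ℕ × ℕ => c p.1 * (gam k p.2 * (p.1 * z) ^ p.2) * q ^ p.1) := hds.of_norm
  have hrow : ∀ n : ℕ, c n * jw (2 * k - 1) (n * z) * q ^ n =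
      ∑' m : ℕ, c n * (gam k m * (n * z) ^ m) * q ^ n := by
    intro n
    rw [jw_eq, tsum_mul_right, tsum_mul_left]
  have hcol : ∀ m : ℕ, ∑' n : ℕ, c n * (gam k m * (n * z) ^ m) * q ^ n = Cq k Pn m q * z ^ m := by
    intro m
    rw [Cq_eq k hk Pn hPnrec c hcs hf m q hq h0, fser, ← tsum_mul_left, ← tsum_mul_right]
    congr 1; ext n; ring
  have s1 : Summable (fun n : ℕ => ‖c n * jw (2 * k - 1) (n * z) * q ^ n‖) := by
    refine Summable.of_nonneg_of_le (fun _ => norm_nonneg _) (fun n => ?_) hds.prod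
    rw [hrow]
    exact norm_tsum_le_tsum_norm (hds.prod_factor n)
  have hsw := hds.prod_symm
  have s2 : Summable (fun m : ℕ => ‖Cq k Pn m q * z ^ m‖) := by
    refine Summable.of_nonneg_of_le (fun _ => norm_nonneg _) (fun m => ?_) hsw.prod
    rw [← hcol]
    exact norm_tsum_le_tsum_norm (hsw.prod_factor m)
  have s3 : Summable (fun j : ℕ => ‖(Sq q * z) ^ j / (Nat.factorial j : ℂ)‖) :=
    NormedSpace.norm_expSeries_div_summable (Sq q * z)
  have hQ : ∀ n : ℕ, Qq k Pn n q * z ^ n = ∑ p ∈ Finset.HasAntidiagonal.antidiagonal n,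
      (Cq k Pn p.1 q * z ^ p.1) * ((Sq q * z) ^ p.2 / (Nat.factorial p.2 : ℂ)) := by
    intro n
    rw [Qq_eq, Finset.sum_mul]
    refine Finset.sum_congr rfl fun p hp => ?_
    rw [← Finset.HasAntidiagonal.mem_antidiagonal.mp hp, pow_add, mul_pow]
    ring
  have s4 := summable_norm_sum_mul_antidiagonal_of_summable_norm s2 s3
  have s5 := tsum_mul_tsum_eq_tsum_sum_antidiagonal_of_summable_norm s2 s3
  simp only [← hQ] at s4 s5
  refine ⟨s1, s4, ?_⟩
  · rw [← s5]
    have hexp : ∑' j : ℕ, (Sq q * z) ^ j / (Nat.factorial j : ℂ) = Complex.exp (Sq q * z) := by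
      rw [Complex.exp_eq_exp_ℂ, NormedSpace.exp_eq_tsum_div]
    rw [hexp]
    simp_rw [hrow]
    rw [← Summable.tsum_comm (f := fun n m => c n * (gam k m * (n * z) ^ m) * q ^ n) hds']
    simp_rw [hcol]
    have : Complex.exp (-Sq q * z) * Complex.exp (Sq q * z) = 1 := by
      rw [← Complex.exp_add]; simp
    linear_combination (-∑' m : ℕ, Cq k Pn m q * z ^ m) * this

/-! ### Back to the upper half plane -/

lemma exp_nat (n : ℕ) (τ : ℂ) : Complex.exp (Real.pi * Complex.I * n * τ) =
    Complex.exp (Real.pi * Complex.I * τ) ^ n := by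
  rw [← Complex.exp_nat_mul]; ring_nf

lemma theta_eq (τ : ℂ) : theta τ = g3 (Complex.exp (Real.pi * Complex.I * τ)) := by
  unfold theta g3 gsum
  congr 1; ext n
  rw [← exp_nat, ← Int.cast_natCast (e3 n), e3_cast]; push_cast; rfl

lemma neg_one_zpow_e3 (n : ℤ) : (-1 : ℂ) ^ n = (-1) ^ (e3 n) := by
  rw [← zpow_natCast, e3_cast]
  rcases Int.even_or_odd n with h | h
  · rw [h.neg_one_zpow, (h.pow_of_ne_zero two_ne_zero).neg_one_zpow]
  · rw [h.neg_one_zpow, (h.pow).neg_one_zpow]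

lemma theta4_eq (τ : ℂ) : theta4 τ = g3 (-Complex.exp (Real.pi * Complex.I * τ)) := by
  unfold theta4 g3 gsum
  congr 1; ext n
  rw [neg_pow, ← exp_nat, ← Int.cast_natCast (e3 n), e3_cast, neg_one_zpow_e3]; push_cast; rfl

lemma theta2_eq (τ : ℂ) : theta2 τ = Complex.exp (Real.pi * Complex.I * τ / 4) *
    g2 (Complex.exp (Real.pi * Complex.I * τ)) := by
  unfold theta2 g2 gsum
  rw [← tsum_mul_left]
  congr 1; ext n
  rw [← exp_nat, ← Int.cast_natCast (e2 n), e2_cast, ← Complex.exp_add]; push_cast; ring_nf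

lemma xx_eq (τ : ℂ) : xx τ = Xq (Complex.exp (Real.pi * Complex.I * τ)) := by
  rw [xx, theta4_eq, Xq]

lemma yy_eq (τ : ℂ) : yy τ = Yq (Complex.exp (Real.pi * Complex.I * τ)) := by
  rw [yy, theta2_eq, Yq, mul_pow, ← Complex.exp_nat_mul]; push_cast; ring_nf

lemma norm_nome {τ : ℂ} (hτ : 0 < τ.im) : ‖Complex.exp (Real.pi * Complex.I * τ)‖ < 1 := by
  rw [Complex.norm_exp]
  simp
  positivity

lemma AA_eq {τ : ℂ} (hτ : 0 < τ.im) :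
    AA τ = -(Real.pi:ℂ) ^ 2 * Sq (Complex.exp (Real.pi * Complex.I * τ)) := by
  have hq := norm_nome hτ
  have hg := g3_ne hq
  have hth : theta = fun τ => g3 (Complex.exp (Real.pi * Complex.I * τ)) := funext theta_eq
  have hin : HasDerivAt (fun τ : ℂ => Complex.exp (Real.pi * Complex.I * τ))
      (Complex.exp (Real.pi * Complex.I * τ) * (Real.pi * Complex.I)) τ := by
    have := ((hasDerivAt_id τ).const_mul (Real.pi * Complex.I : ℂ)).cexp
    simpa using this
  have hd : deriv theta τ = deriv g3 (Complex.exp (Real.pi * Complex.I * τ)) *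
      (Complex.exp (Real.pi * Complex.I * τ) * (Real.pi * Complex.I)) := by
    rw [hth]
    exact ((hd3 hq).comp τ hin).deriv
  have hpi : (Real.pi : ℂ) ≠ 0 := by exact_mod_cast Real.pi_ne_zero
  rw [AA, tt, hd, theta_eq, Sq, LL]
  field_simp [Complex.I_ne_zero]
  ring

lemma exists_tau {q : ℂ} (hq : ‖q‖ < 1) (h0 : q ≠ 0) :
    ∃ τ : ℂ, 0 < τ.im ∧ Complex.exp (Real.pi * Complex.I * τ) = q := by
  have hpi : (Real.pi : ℂ) ≠ 0 := by exact_mod_cast Real.pi_ne_zero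
  refine ⟨Complex.log q / (Real.pi * Complex.I), ?_, ?_⟩
  · have e : Complex.log q / (Real.pi * Complex.I) = ((Real.pi⁻¹ : ℝ) : ℂ) * (-Complex.I * Complex.log q) := by
      push_cast
      field_simp
      simp
    have hl : Real.log ‖q‖ < 0 := Real.log_neg (norm_pos_iff.mpr h0) hq
    rw [e, Complex.im_ofReal_mul]
    have : (-Complex.I * Complex.log q).im = -Real.log ‖q‖ := by simp [Complex.log_re]
    rw [this]
    exact mul_pos (inv_pos.mpr Real.pi_pos) (by linarith)
  · rw [mul_div_cancel₀ _ (mul_ne_zero hpi Complex.I_ne_zero), Complex.exp_log h0]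

lemma eval_homog (k : ℕ) (P : MvPolynomial (Fin 2) ℂ) (hP : P.IsHomogeneous k) (x y : ℂ)
    (hx : x ≠ 0) : MvPolynomial.eval ![x, y] P =
      x ^ k * (MvPolynomial.aeval ![(1 : Polynomial ℂ), Polynomial.X] P).eval (y / x) := by
  have h1 : (MvPolynomial.aeval ![(1 : Polynomial ℂ), Polynomial.X] P).eval (y / x) =
      MvPolynomial.eval ![1, y / x] P := by
    rw [MvPolynomial.aeval_def, MvPolynomial.eval₂_eq', MvPolynomial.eval_eq', Polynomial.eval_finsetSum]
    refine Finset.sum_congr rfl fun d _ => ?_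
    simp
  rw [h1, MvPolynomial.eval_eq', MvPolynomial.eval_eq', Finset.mul_sum]
  refine Finset.sum_congr rfl fun d hd => ?_
  have hdeg := hP (MvPolynomial.mem_support_iff.mp hd)
  rw [Finsupp.weight_apply, Finsupp.sum_fintype _ _ (by simp)] at hdeg
  simp [Fin.sum_univ_two] at hdeg
  simp [Fin.prod_univ_two]
  rw [← hdeg, pow_add, div_pow]
  field_simp

/-- For every `τ ∈ ℍ` and `z ∈ ℂ`, both series converge absolutely and
`∑_{n≥0} c(n) j_{2k-1}(π²nz) e^{πinτ} = e^{A(τ)z} ∑_{n≥0} π^{2n} x(τ)^{n+k} Pₙ(u(τ)) zⁿ`. -/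
theorem cohen_kuznetsov_expansion_polynomial_case
    (k : ℕ) (hk : 1 ≤ k)
    (P : MvPolynomial (Fin 2) ℂ) (hP : P.IsHomogeneous k)
    (Pn : ℕ → Polynomial ℂ)
    (hPn0 : Pn 0 = MvPolynomial.aeval ![1, Polynomial.X] P)
    (hPnrec : ∀ n : ℕ,
      (((n : ℂ) + 1) * ((n : ℂ) + 2 * k)) • Pn (n + 1)
        + (X ^ 2 - X) * Polynomial.derivative (Pn n)
        - ((n : ℂ) + k) • (X * Pn n)
        + (1/4 : ℂ) • (X * (if n = 0 then 0 else Pn (n - 1))) = 0)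
    (c : ℕ → ℂ)
    (hcsum : ∀ τ : ℂ, 0 < τ.im →
      Summable (fun n : ℕ => ‖c n * Complex.exp (Real.pi * Complex.I * n * τ)‖))
    (hc : ∀ τ : ℂ, 0 < τ.im →
      MvPolynomial.eval ![xx τ, yy τ] P
        = ∑' n : ℕ, c n * Complex.exp (Real.pi * Complex.I * n * τ))
    (τ : ℂ) (hτ : 0 < τ.im) (z : ℂ) :
    Summable (fun n : ℕ => ‖c n * jw (2 * k - 1) ((Real.pi : ℂ) ^ 2 * n * z) *
      Complex.exp (Real.pi * Complex.I * n * τ)‖) ∧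
    Summable (fun n : ℕ => ‖(Real.pi : ℂ) ^ (2 * n) * (xx τ) ^ (n + k) *
      (Pn n).eval (uu τ) * z ^ n‖) ∧
    ∑' n : ℕ, c n * jw (2 * k - 1) ((Real.pi : ℂ) ^ 2 * n * z) *
        Complex.exp (Real.pi * Complex.I * n * τ)
      = Complex.exp (AA τ * z) *
        ∑' n : ℕ, (Real.pi : ℂ) ^ (2 * n) * (xx τ) ^ (n + k) *
          (Pn n).eval (uu τ) * z ^ n := by
  have hcs : ∀ r : ℝ, 0 < r → r < 1 → Summable (fun n => ‖c n‖ * r ^ n) := by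
    intro r hr hr1
    obtain ⟨σ, hσ, hσ'⟩ := exists_tau (q := (r : ℂ)) (by simpa [abs_of_pos hr] using hr1)
      (by exact_mod_cast hr.ne')
    have h := hcsum σ hσ
    simp only [exp_nat, hσ', norm_mul, norm_pow, Complex.norm_real, Real.norm_eq_abs,
      abs_of_pos hr] at h
    exact h
  have hf : ∀ q : ℂ, ‖q‖ < 1 → q ≠ 0 → Qq k Pn 0 q = fser c 0 q := by
    intro q hq h0
    obtain ⟨σ, hσ, hσ'⟩ := exists_tau hq h0
    have h := hc σ hσ
    simp only [exp_nat, xx_eq, yy_eq, hσ'] at h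
    rw [eval_homog k P hP _ _ (Xq_ne hq), ← hPn0] at h
    simp only [Qq, fser, zero_add, pow_zero, one_mul]
    exact h
  have hq := norm_nome hτ
  have hm := main_q k hk Pn hPnrec c hcs hf hq (Complex.exp_ne_zero _) ((Real.pi : ℂ) ^ 2 * z)
  have e1 : ∀ n : ℕ, (n : ℂ) * ((Real.pi : ℂ) ^ 2 * z) = (Real.pi : ℂ) ^ 2 * n * z := by
    intro n; ring
  have e2 : ∀ n : ℕ, Qq k Pn n (Complex.exp (Real.pi * Complex.I * τ)) *
      ((Real.pi : ℂ) ^ 2 * z) ^ n =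
      (Real.pi : ℂ) ^ (2 * n) * (xx τ) ^ (n + k) * (Pn n).eval (uu τ) * z ^ n := by
    intro n
    rw [Qq, uu, xx_eq, yy_eq, mul_pow, ← pow_mul]; ring
  have e3 : -Sq (Complex.exp (Real.pi * Complex.I * τ)) * ((Real.pi : ℂ) ^ 2 * z) = AA τ * z := by
    rw [AA_eq hτ]; ring
  simp only [e1, e2, e3, ← exp_nat] at hm
  exact hm
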